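/- arXiv:1509.02801 — 3 statements merged into one kernel-verified Lean document; each statement's English description precedes it below -/
import Mathlib

section
/- Let n and k be integers with 3 ≤ k ≤ n, and let G be a simple graph of order n such that both G and its complement Ḡ are connected. Then sdiam_k(G) · sdiam_k(Ḡ) ≤ max{k(n − 1), (2k − 1)²}. Moreover, sdiam_k(G) · sdiam_k(Ḡ) ≥ (k − 1)², and if in addition n ≥ 2k − 2 then sdiam_k(G) · sdiam_k(Ḡ) ≥ k(k − 1). -/
open SimpleGraph

/-- Steiner distance of a set of vertices `S` in `G`: the minimum number of edges of a
connected subgraph of `G` whose vertex set contains `S`. -/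
noncomputable def steinerDist {V : Type*} (G : SimpleGraph V) (S : Set V) : ℕ :=
  sInf {m | ∃ H : G.Subgraph, H.Connected ∧ S ⊆ H.verts ∧ H.edgeSet.ncard = m}

/-- Steiner `k`-diameter of `G`: the maximum Steiner distance over all `k`-element
subsets of the vertex set. -/
noncomputable def steinerDiam {V : Type*} [Fintype V] [DecidableEq V]
    (G : SimpleGraph V) (k : ℕ) : ℕ :=
  (Finset.univ.powersetCard k).sup (fun S : Finset V => steinerDist G (S : Set V))

lemma ncard_edgeSet_coe {V : Type*} {G : SimpleGraph V} (H : G.Subgraph) :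
    H.edgeSet.ncard = H.coe.edgeSet.ncard := by
  rw [← H.image_coe_edgeSet_coe]
  exact Set.ncard_image_of_injective _ (Sym2.map.injective Subtype.val_injective)

/-- A connected induced subgraph on `T ⊇ S` bounds the Steiner distance of `S`. -/
lemma steinerDist_add_one_le {V : Type*} [Fintype V] [DecidableEq V] (G : SimpleGraph V)
    (S : Set V) (T : Finset V) (hST : S ⊆ T) (hT : (G.induce (T : Set V)).Connected) :
    steinerDist G S + 1 ≤ T.card := by
  classical
  obtain ⟨F, hFle, hF⟩ := hT.exists_isTree_le
  let H : G.Subgraph :=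
    { verts := T
      Adj := fun u v => ∃ (hu : u ∈ (T : Set V)) (hv : v ∈ (T : Set V)), F.Adj ⟨u, hu⟩ ⟨v, hv⟩
      adj_sub := by
        rintro u v ⟨hu, hv, h⟩
        exact hFle h
      edge_vert := by
        rintro u v ⟨hu, hv, h⟩
        exact hu
      symm := ⟨by
        rintro u v ⟨hu, hv, h⟩
        exact ⟨hv, hu, h.symm⟩⟩ }
  have hcoe : H.coe = F := by
    ext u v
    simp only [Subgraph.coe_adj]
    exact ⟨fun ⟨_, _, h⟩ => h, fun h => ⟨u.2, v.2, h⟩⟩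
  have hconn : H.Connected := by
    rw [Subgraph.connected_iff', hcoe]
    exact hF.connected
  have hle : steinerDist G S ≤ H.edgeSet.ncard := Nat.sInf_le ⟨H, hconn, hST, rfl⟩
  have h1 := hF.card_edgeFinset
  have h2 : H.edgeSet.ncard = F.edgeFinset.card := by
    rw [ncard_edgeSet_coe, hcoe, ← Set.ncard_coe_finset, coe_edgeFinset]
  simp at h1
  omega

/-- An optimal Steiner subgraph. -/
lemma exists_steiner {V : Type*} [Fintype V] [DecidableEq V] (G : SimpleGraph V)
    (hG : G.Connected) (S : Set V) :
    ∃ H : G.Subgraph, H.Connected ∧ S ⊆ H.verts ∧ H.edgeSet.ncard = steinerDist G S := by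
  have hne : {m | ∃ H : G.Subgraph, H.Connected ∧ S ⊆ H.verts ∧ H.edgeSet.ncard = m}.Nonempty := by
    refine ⟨_, toSubgraph G le_rfl, hG.toSubgraph _, ?_, rfl⟩
    intro x _
    simp
  exact Nat.sInf_mem hne

lemma exists_verts_steiner {V : Type*} [Fintype V] [DecidableEq V] (G : SimpleGraph V)
    (hG : G.Connected) (S : Set V) :
    ∃ T : Set V, (G.induce T).Connected ∧ S ⊆ T ∧ T.ncard ≤ steinerDist G S + 1 := by
  classical
  obtain ⟨H, hc, hS, he⟩ := exists_steiner G hG S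
  refine ⟨H.verts, hc.induce_verts, hS, ?_⟩
  rw [Subgraph.connected_iff'] at hc
  have := hc.card_vert_le_card_edgeSet_add_one
  rw [← he, ncard_edgeSet_coe]
  rwa [Nat.card_coe_set_eq, Nat.card_coe_set_eq] at this

lemma card_le_steinerDist {V : Type*} [Fintype V] [DecidableEq V] (G : SimpleGraph V)
    (hG : G.Connected) (S : Finset V) : S.card ≤ steinerDist G (S : Set V) + 1 := by
  obtain ⟨T, _, h1, h2⟩ := exists_verts_steiner G hG S
  have := Set.ncard_le_ncard h1 (Set.toFinite T)
  rw [Set.ncard_coe_finset] at this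
  omega

lemma induce_connected_of_steinerDist {V : Type*} [Fintype V] [DecidableEq V]
    (G : SimpleGraph V) (hG : G.Connected) (S : Finset V)
    (h : steinerDist G (S : Set V) + 1 ≤ S.card) : (G.induce (S : Set V)).Connected := by
  obtain ⟨T, hc, h1, h2⟩ := exists_verts_steiner G hG S
  have : (S : Set V) = T := by
    apply Set.eq_of_subset_of_ncard_le h1 _ (Set.toFinite T)
    rw [Set.ncard_coe_finset]
    omega
  rw [this]
  exact hc

/-- Adding dominated vertices keeps an induced subgraph connected. -/
lemma induce_connected_of_dominated {V : Type*} (G : SimpleGraph V) (D U : Set V) (hDU : D ⊆ U)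
    (hD : (G.induce D).Connected) (hdom : ∀ u ∈ U, u ∉ D → ∃ d ∈ D, G.Adj u d) :
    (G.induce U).Connected := by
  obtain ⟨⟨d0, hd0⟩⟩ := hD.nonempty
  have key : ∀ d (hd : d ∈ D), (G.induce U).Reachable ⟨d, hDU hd⟩ ⟨d0, hDU hd0⟩ := by
    intro d hd
    exact (hD.preconnected ⟨d, hd⟩ ⟨d0, hd0⟩).map (induceHomOfLE G hDU).toHom
  have key2 : ∀ u : U, (G.induce U).Reachable u ⟨d0, hDU hd0⟩ := by
    rintro ⟨u, hu⟩
    by_cases hud : u ∈ D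
    · exact key u hud
    · obtain ⟨d, hd, ha⟩ := hdom u hu hud
      have : (G.induce U).Adj ⟨u, hu⟩ ⟨d, hDU hd⟩ := ha
      exact this.reachable.trans (key d hd)
  have : Nonempty U := ⟨⟨d0, hDU hd0⟩⟩
  exact ⟨fun u v => (key2 u).trans (key2 v).symm⟩

lemma induce_singleton_connected {V : Type*} (G : SimpleGraph V) (v : V) :
    (G.induce ({v} : Set V)).Connected := by
  have : Nonempty ({v} : Set V) := ⟨⟨v, rfl⟩⟩
  refine ⟨fun a b => ?_⟩
  rw [Subsingleton.elim a b]

lemma steiner_key {V : Type*} [Fintype V] [DecidableEq V] (G : SimpleGraph V)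
    (S T : Finset V) (hS : S.Nonempty) (h : S.card + 1 ≤ steinerDist Gᶜ (S : Set V)) :
    steinerDist G (T : Set V) + 1 ≤ S.card + T.card := by
  have hnc : ¬ (Gᶜ.induce (S : Set V)).Connected := by
    intro hc
    have := steinerDist_add_one_le Gᶜ S S le_rfl hc
    omega
  have hSc : (G.induce (S : Set V)).Connected := by
    have : Nonempty (S : Set V) := ⟨⟨hS.choose, hS.choose_spec⟩⟩
    rcases (G.induce (S : Set V)).connected_or_connected_compl with h1 | h1
    · exact h1
    · exfalso
      apply hnc
      refine h1.mono ?_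
      intro u v huv
      simp only [compl_adj, comap_adj] at huv ⊢
      exact ⟨fun h => huv.1 (Subtype.ext h), huv.2⟩
  have hdom : ∀ v, v ∉ S → ∃ d ∈ S, G.Adj v d := by
    intro v hv
    by_contra! hno
    have hc : (Gᶜ.induce ((insert v S : Finset V) : Set V)).Connected := by
      refine induce_connected_of_dominated Gᶜ {v} _ (by simp) (induce_singleton_connected _ v) ?_
      intro u hu huv
      have huv' : u ≠ v := huv
      have huS : u ∈ S := by
        rcases Finset.mem_insert.1 (Finset.mem_coe.1 hu) with h | h
        · exact absurd h huv'
        · exact h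
      exact ⟨v, rfl, (compl_adj G u v).2 ⟨huv', fun h => hno u huS h.symm⟩⟩
    have := steinerDist_add_one_le Gᶜ (S : Set V) (insert v S) (by simp) hc
    rw [Finset.card_insert_of_notMem hv] at this
    omega
  have hc : (G.induce ((S ∪ T : Finset V) : Set V)).Connected := by
    refine induce_connected_of_dominated G S _ (by simp) hSc ?_
    intro u _ huS
    obtain ⟨d, hd, ha⟩ := hdom u (by simpa using huS)
    exact ⟨d, hd, ha⟩
  have h1 := steinerDist_add_one_le G (T : Set V) (S ∪ T) (by simp) hc
  have := Finset.card_union_le S T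
  omega

lemma steinerDist_le_diam {V : Type*} [Fintype V] [DecidableEq V] (G : SimpleGraph V)
    (S : Finset V) : steinerDist G (S : Set V) ≤ steinerDiam G S.card :=
  Finset.le_sup (f := fun S : Finset V => steinerDist G (S : Set V))
    (Finset.mem_powersetCard.2 ⟨Finset.subset_univ S, rfl⟩)

lemma steinerDiam_lt {V : Type*} [Fintype V] [DecidableEq V] (G : SimpleGraph V)
    (hG : G.Connected) (k : ℕ) : steinerDiam G k ≤ Fintype.card V - 1 := by
  refine Finset.sup_le fun S _ => ?_
  have := steinerDist_add_one_le G (S : Set V) Finset.univ (by simp) (by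
    rw [Finset.coe_univ]
    exact (induceUnivIso G).connected_iff.2 hG)
  rw [Finset.card_univ] at this
  omega

lemma steinerDiam_upper {V : Type*} [Fintype V] [DecidableEq V] (G : SimpleGraph V)
    (k : ℕ) (hk : 1 ≤ k) (h : k + 1 ≤ steinerDiam Gᶜ k) : steinerDiam G k ≤ 2 * k - 1 := by
  obtain ⟨S, hS, hd⟩ := (Finset.lt_sup_iff).1 (Nat.lt_of_succ_le h)
  have hSk := (Finset.mem_powersetCard.1 hS).2
  refine Finset.sup_le fun T hT => ?_
  have hTk := (Finset.mem_powersetCard.1 hT).2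
  have := steiner_key G S T (Finset.card_pos.1 (by omega)) (by omega)
  omega

lemma le_steinerDiam {V : Type*} [Fintype V] [DecidableEq V] (G : SimpleGraph V)
    (hG : G.Connected) (k : ℕ) (hk : k ≤ Fintype.card V) : k - 1 ≤ steinerDiam G k := by
  obtain ⟨S, -, hS⟩ := Finset.exists_subset_card_eq (s := (Finset.univ : Finset V)) (n := k)
    (by rwa [Finset.card_univ])
  have h1 := steinerDist_le_diam G S
  have h2 := card_le_steinerDist G hG S
  rw [hS] at h1 h2
  omega

/-- If every `k`-set is connected, every vertex has fewer than `k - 1` non-neighbours. -/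
lemma nonneighbors_lt {V : Type*} [Fintype V] [DecidableEq V] (G : SimpleGraph V)
    (hG : G.Connected) (k : ℕ) (hk : 2 ≤ k) (h : steinerDiam G k ≤ k - 1) (v : V)
    (A : Finset V) (hv : v ∉ A) (hA : ∀ a ∈ A, ¬ G.Adj v a) : A.card < k - 1 := by
  by_contra! hlt
  obtain ⟨B, hBA, hB⟩ := Finset.exists_subset_card_eq hlt
  have hvB : v ∉ B := fun h => hv (hBA h)
  have hcard : (insert v B).card = k := by
    rw [Finset.card_insert_of_notMem hvB]
    omega
  have h1 := steinerDist_le_diam G (insert v B)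
  rw [hcard] at h1
  have hc := induce_connected_of_steinerDist G hG (insert v B) (by omega)
  obtain ⟨b, hb⟩ := Finset.card_pos.1 (show 0 < B.card by omega)
  have hnt : Nontrivial ((insert v B : Finset V) : Set V) :=
    ⟨⟨v, by simp⟩, ⟨b, by simp [hb]⟩, fun e => hvB (by
      have := congrArg Subtype.val e
      simp only at this
      rwa [this])⟩
  obtain ⟨⟨w, hw⟩, ha⟩ := hc.preconnected.exists_adj_of_nontrivial ⟨v, by simp⟩
  have ha' : G.Adj v w := ha
  rcases Finset.mem_insert.1 (Finset.mem_coe.1 hw) with h | h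
  · exact ha'.ne h.symm
  · exact hA w (hBA h) ha'

/-- Nordhaus–Gaddum bounds for the product `sdiam_k(G) · sdiam_k(Ḡ)` where `3 ≤ k ≤ n`
and both `G` and its complement are connected. -/
theorem steinerDiam_mul_compl_bounds {V : Type*} [Fintype V] [DecidableEq V]
    (G : SimpleGraph V) (n k : ℕ) (hn : Fintype.card V = n)
    (hk : 3 ≤ k) (hkn : k ≤ n) (hG : G.Connected) (hGc : Gᶜ.Connected) :
    steinerDiam G k * steinerDiam Gᶜ k ≤ max (k * (n - 1)) ((2 * k - 1) ^ 2) ∧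
    (k - 1) ^ 2 ≤ steinerDiam G k * steinerDiam Gᶜ k ∧
    (2 * k - 2 ≤ n → k * (k - 1) ≤ steinerDiam G k * steinerDiam Gᶜ k) := by
  classical
  subst hn
  have la := le_steinerDiam G hG k hkn
  have lb := le_steinerDiam Gᶜ hGc k hkn
  refine ⟨?_, ?_, ?_⟩
  · have ua := steinerDiam_lt G hG k
    have ub := steinerDiam_lt Gᶜ hGc k
    rcases Nat.lt_or_ge k (steinerDiam G k) with h1 | h1
    · rcases Nat.lt_or_ge k (steinerDiam Gᶜ k) with h2 | h2
      · refine le_trans ?_ (le_max_right _ _)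
        rw [sq]
        exact Nat.mul_le_mul (steinerDiam_upper G k (by omega) h2)
          (steinerDiam_upper Gᶜ k (by omega) (by rw [compl_compl]; exact h1))
      · refine le_trans ?_ (le_max_left _ _)
        rw [mul_comm]
        exact Nat.mul_le_mul h2 ua
    · exact le_trans (Nat.mul_le_mul h1 ub) (le_max_left _ _)
  · rw [sq]
    exact Nat.mul_le_mul la lb
  · intro hn
    rcases Nat.lt_or_ge (k - 1) (steinerDiam G k) with h1 | h1
    · exact Nat.mul_le_mul (by omega) lb
    rcases Nat.lt_or_ge (k - 1) (steinerDiam Gᶜ k) with h2 | h2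
    · rw [mul_comm]
      exact Nat.mul_le_mul la (by omega)
    exfalso
    obtain ⟨v⟩ := hG.nonempty
    have c1 := nonneighbors_lt G hG k (by omega) h1 v
      ((Finset.univ.erase v).filter (fun a => ¬ G.Adj v a)) (by simp) (by simp)
    have c2 := nonneighbors_lt Gᶜ hGc k (by omega) h2 v
      ((Finset.univ.erase v).filter (fun a => G.Adj v a)) (by simp) (by simp +contextual)
    have c3 := Finset.card_filter_add_card_filter_not (s := Finset.univ.erase v)
      (fun a => G.Adj v a)
    rw [Finset.card_erase_of_mem (Finset.mem_univ v), Finset.card_univ] at c3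
    omega
end

section
/- Let G be a simple graph of order n ≥ 5 such that both G and its complement Ḡ are connected. Then: (a) sdiam_{n−1}(G) + sdiam_{n−1}(Ḡ) = 2n − 4 if and only if both G and Ḡ are 2-connected; and (b) sdiam_{n−1}(G) + sdiam_{n−1}(Ḡ) = 2n − 3 if and only if exactly one of G and Ḡ is 2-connected (i.e., one of G, Ḡ is 2-connected and the other has a cut vertex). -/
open SimpleGraph

/-- A graph is 2-connected if it is connected, has at least 3 vertices, and has no cut
vertex (removing any single vertex leaves a connected graph). -/
def IsTwoConnected {V : Type*} [Fintype V] (G : SimpleGraph V) : Prop :=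
  G.Connected ∧ 3 ≤ Fintype.card V ∧
    ∀ v : V, (G.induce {u : V | u ≠ v}).Connected

lemma sd_verts_le {V : Type*} [Finite V] {G : SimpleGraph V} (H : G.Subgraph)
    (hH : H.Connected) : H.verts.ncard ≤ H.edgeSet.ncard + 1 := by
  have h := hH.coe.card_vert_le_card_edgeSet_add_one
  have h2 : Nat.card H.coe.edgeSet = H.edgeSet.ncard := by
    rw [← H.image_coe_edgeSet_coe, Set.ncard_image_of_injective _
      (Sym2.map.injective Subtype.val_injective)]
    rfl
  rw [h2] at h
  exact h

lemma sd_of_connected {V W : Type*} [Finite W] {G : SimpleGraph V} (K : SimpleGraph W)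
    (hK : K.Connected) (f : K →g G) :
    ∃ H : G.Subgraph, H.Connected ∧ H.verts = Set.range f ∧
      H.edgeSet.ncard + 1 ≤ Nat.card W := by
  obtain ⟨T, hle, hT⟩ := hK.exists_isTree_le
  let g : T →g G := f.comp (Hom.ofLE hle)
  refine ⟨(⊤ : T.Subgraph).map g, ⟨?_⟩, ?_, ?_⟩
  · let k : T →g ((⊤ : T.Subgraph).map g).coe :=
      { toFun := fun w => ⟨g w, ⟨w, trivial, rfl⟩⟩
        map_rel' := fun {a b} h => ⟨a, b, h, rfl, rfl⟩ }
    refine hT.connected.map k ?_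
    rintro ⟨_, w, _, rfl⟩
    exact ⟨w, rfl⟩
  · ext x
    simp [g]
  · rw [Subgraph.edgeSet_map, Subgraph.edgeSet_top]
    have h := (isTree_iff_connected_and_card.1 hT).2
    have h3 : (Sym2.map g '' T.edgeSet).ncard ≤ T.edgeSet.ncard :=
      Set.ncard_image_le (Set.toFinite _)
    have h4 : T.edgeSet.ncard = Nat.card T.edgeSet := rfl
    omega

lemma sd_le {V W : Type*} [Finite W] {G : SimpleGraph V} (K : SimpleGraph W)
    (hK : K.Connected) (f : K →g G) (S : Set V) (hS : S ⊆ Set.range f) :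
    steinerDist G S + 1 ≤ Nat.card W := by
  obtain ⟨H, h1, h2, h3⟩ := sd_of_connected K hK f
  have : steinerDist G S ≤ H.edgeSet.ncard := Nat.sInf_le ⟨H, h1, h2 ▸ hS, rfl⟩
  omega

lemma sd_attain {V : Type*} [Finite V] {G : SimpleGraph V} (hG : G.Connected) (S : Set V) :
    ∃ H : G.Subgraph, H.Connected ∧ S ⊆ H.verts ∧ H.edgeSet.ncard = steinerDist G S := by
  obtain ⟨H, h1, h2, -⟩ := sd_of_connected G hG Hom.id
  exact Nat.sInf_mem (s := {m | ∃ H : G.Subgraph, H.Connected ∧ S ⊆ H.verts ∧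
    H.edgeSet.ncard = m}) ⟨_, H, h1, by rw [h2]; intro x _; exact ⟨x, rfl⟩, rfl⟩

lemma sdiam_cases {V : Type*} [Fintype V] [DecidableEq V]
    (G : SimpleGraph V) (n : ℕ) (hn : Fintype.card V = n) (hn5 : 5 ≤ n) (hG : G.Connected) :
    (IsTwoConnected G ∧ steinerDiam G (n - 1) = n - 2) ∨
      (¬ IsTwoConnected G ∧ steinerDiam G (n - 1) = n - 1) := by
  have hcard : Nat.card V = n := by rw [Nat.card_eq_fintype_card, hn]
  have hub : steinerDiam G (n - 1) ≤ n - 1 := by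
    refine Finset.sup_le fun S _ => ?_
    have := sd_le G hG Hom.id (S : Set V) (fun x _ => ⟨x, rfl⟩)
    omega
  have hmem : ∀ v : V, steinerDist G {u : V | u ≠ v} ≤ steinerDiam G (n - 1) := by
    intro v
    have h1 : (Finset.univ.erase v) ∈ (Finset.univ : Finset V).powersetCard (n - 1) := by
      rw [Finset.mem_powersetCard]
      refine ⟨Finset.subset_univ _, ?_⟩
      rw [Finset.card_erase_of_mem (Finset.mem_univ _), Finset.card_univ, hn]
    have h2 := Finset.le_sup (f := fun S : Finset V => steinerDist G (S : Set V)) h1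
    have h3 : ((Finset.univ.erase v : Finset V) : Set V) = {u : V | u ≠ v} := by
      ext x; simp
    simp only [h3] at h2
    exact h2
  have hnc : ∀ v : V, ({u : V | u ≠ v}).ncard = n - 1 := by
    intro v
    have h3 : ({u : V | u ≠ v}) = ((Finset.univ.erase v : Finset V) : Set V) := by
      ext x; simp
    rw [h3, Set.ncard_coe_finset, Finset.card_erase_of_mem (Finset.mem_univ _),
      Finset.card_univ, hn]
  have hlb : ∀ v : V, n - 2 ≤ steinerDist G {u : V | u ≠ v} := by
    intro v
    obtain ⟨H, h1, h2, h3⟩ := sd_attain hG {u : V | u ≠ v}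
    have h4 := sd_verts_le H h1
    have h5 := Set.ncard_le_ncard h2 (Set.toFinite _)
    rw [hnc] at h5
    omega
  obtain ⟨v0⟩ := hG.nonempty
  by_cases h : IsTwoConnected G
  · left
    refine ⟨h, le_antisymm ?_ ((hlb v0).trans (hmem v0))⟩
    refine Finset.sup_le fun S hS => ?_
    rw [Finset.mem_powersetCard] at hS
    have hc : (Sᶜ).card = 1 := by rw [Finset.card_compl, hS.2, hn]; omega
    obtain ⟨v, hv⟩ := Finset.card_eq_one.1 hc
    have := sd_le _ (h.2.2 v) (Embedding.induce {u : V | u ≠ v}).toHom (S : Set V) (by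
      intro x hx
      refine ⟨⟨x, ?_⟩, rfl⟩
      rintro rfl
      have : x ∈ Sᶜ := by rw [hv]; simp
      exact (Finset.mem_compl.1 this) hx)
    have h6 : Nat.card ↑{u : V | u ≠ v} = n - 1 := hnc v
    omega
  · right
    refine ⟨h, le_antisymm hub ?_⟩
    by_contra hlt
    apply h
    refine ⟨hG, by omega, fun v => ?_⟩
    obtain ⟨H, h1, h2, h3⟩ := sd_attain hG {u : V | u ≠ v}
    have h4 := sd_verts_le H h1
    have h5 := hmem v
    have h6 : {u : V | u ≠ v} = H.verts :=
      Set.eq_of_subset_of_ncard_le h2 (by rw [hnc]; omega) (Set.toFinite _)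
    rw [h6]
    exact h1.coe.mono fun a b hab => H.adj_sub hab

/-- For a graph `G` of order `n ≥ 5` with `G` and `Ḡ` connected:
`sdiam_{n-1}(G) + sdiam_{n-1}(Ḡ) = 2n - 4` iff both `G` and `Ḡ` are 2-connected, and
`sdiam_{n-1}(G) + sdiam_{n-1}(Ḡ) = 2n - 3` iff exactly one of `G`, `Ḡ` is 2-connected. -/
theorem steinerDiam_pred_sum_characterization {V : Type*} [Fintype V] [DecidableEq V]
    (G : SimpleGraph V) (n : ℕ) (hn : Fintype.card V = n) (hn5 : 5 ≤ n)
    (hG : G.Connected) (hGc : Gᶜ.Connected) :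
    (steinerDiam G (n - 1) + steinerDiam Gᶜ (n - 1) = 2 * n - 4 ↔
      (IsTwoConnected G ∧ IsTwoConnected Gᶜ)) ∧
    (steinerDiam G (n - 1) + steinerDiam Gᶜ (n - 1) = 2 * n - 3 ↔
      ((IsTwoConnected G ∧ ¬ IsTwoConnected Gᶜ) ∨
        (IsTwoConnected Gᶜ ∧ ¬ IsTwoConnected G))) := by
  rcases sdiam_cases G n hn hn5 hG with ⟨h1, e1⟩ | ⟨h1, e1⟩ <;>
    rcases sdiam_cases Gᶜ n hn hn5 hGc with ⟨h2, e2⟩ | ⟨h2, e2⟩ <;>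
    rw [e1, e2] <;> simp only [h1, h2, not_true_eq_false, not_false_eq_true, and_true,
      and_false, or_true, or_false, true_and, false_and, iff_true, iff_false] <;> omega
end

section
/- Let G be a connected simple graph of order n ≥ 3. Then sdiam_{n−1}(G) = n − 2 if and only if G is 2-connected. -/
open SimpleGraph

/-- A connected subgraph has at most one more vertex than edges. -/
lemma subgraph_card_le {V : Type*} [Fintype V] {G : SimpleGraph V} (H : G.Subgraph)
    (hH : H.Connected) : H.verts.ncard ≤ H.edgeSet.ncard + 1 := by
  classical
  have h := hH.coe.card_vert_le_card_edgeSet_add_one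
  have h2 : Nat.card H.coe.edgeSet ≤ H.edgeSet.ncard := by
    rw [Nat.card_coe_set_eq]
    refine Set.ncard_le_ncard_of_injOn (Sym2.map Subtype.val) ?_ ?_ (Set.toFinite _)
    · intro e he
      induction e using Sym2.ind with
      | _ a b => simpa using he
    · exact (Sym2.map.injective Subtype.val_injective).injOn
  rw [← Nat.card_coe_set_eq]
  omega

/-- A connected induced subgraph has a spanning tree. -/
lemma exists_tree_subgraph {V : Type*} [Fintype V] {G : SimpleGraph V} (s : Set V)
    (hs : (G.induce s).Connected) :
    ∃ H : G.Subgraph, H.Connected ∧ H.verts = s ∧ H.edgeSet.ncard + 1 = s.ncard := by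
  classical
  obtain ⟨T, hT, hTree⟩ := hs.exists_isTree_le
  let H : G.Subgraph :=
    { verts := s
      Adj := fun a b => ∃ (ha : a ∈ s) (hb : b ∈ s), T.Adj ⟨a, ha⟩ ⟨b, hb⟩
      adj_sub := by
        rintro a b ⟨ha, hb, h⟩
        exact hT h
      edge_vert := by
        rintro a b ⟨ha, hb, h⟩
        exact ha
      symm := ⟨by
        rintro a b ⟨ha, hb, h⟩
        exact ⟨hb, ha, h.symm⟩⟩ }
  refine ⟨H, ⟨?_⟩, rfl, ?_⟩
  · refine hTree.connected.mono ?_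
    intro a b h
    exact ⟨a.2, b.2, h⟩
  · have he : H.edgeSet = Sym2.map Subtype.val '' T.edgeSet := by
      ext e
      constructor
      · induction e using Sym2.ind with
        | _ a b =>
          rintro ⟨ha, hb, h⟩
          exact ⟨s(⟨a, ha⟩, ⟨b, hb⟩), h, rfl⟩
      · rintro ⟨e, h, rfl⟩
        induction e using Sym2.ind with
        | _ a b => exact ⟨a.2, b.2, h⟩
    rw [he, Set.ncard_image_of_injective _ (Sym2.map.injective Subtype.val_injective)]
    have := hTree.card_edgeFinset
    rw [← Nat.card_coe_set_eq s, Nat.card_eq_fintype_card, ← this, Set.ncard_eq_toFinset_card']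
    rfl

/-- The Steiner distance is attained in a connected graph. -/
lemma steinerDist_attained {V : Type*} (G : SimpleGraph V) (hG : G.Connected) (S : Set V) :
    ∃ H : G.Subgraph, H.Connected ∧ S ⊆ H.verts ∧ H.edgeSet.ncard = steinerDist G S := by
  have hne : {m | ∃ H : G.Subgraph, H.Connected ∧ S ⊆ H.verts ∧ H.edgeSet.ncard = m}.Nonempty :=
    ⟨_, ⊤, ⟨(Subgraph.topIso).connected_iff.mpr hG⟩, by simp, rfl⟩
  exact Nat.sInf_mem hne

lemma ncard_ne {V : Type*} [Fintype V] (v : V) :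
    {u : V | u ≠ v}.ncard = Fintype.card V - 1 := by
  have : {u : V | u ≠ v} = {v}ᶜ := rfl
  rw [this, Set.ncard_compl, Set.ncard_singleton, Nat.card_eq_fintype_card]

lemma le_steinerDist {V : Type*} [Fintype V] (G : SimpleGraph V) (hG : G.Connected) (S : Set V) :
    S.ncard ≤ steinerDist G S + 1 := by
  obtain ⟨H, hH, hS, he⟩ := steinerDist_attained G hG S
  rw [← he]
  exact (Set.ncard_le_ncard hS (Set.toFinite _)).trans (subgraph_card_le H hH)

/-- For a connected graph `G` of order `n ≥ 3`, `sdiam_{n-1}(G) = n - 2` iff `G` is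
2-connected. -/
theorem steinerDiam_pred_eq_iff_twoConnected {V : Type*} [Fintype V] [DecidableEq V]
    (G : SimpleGraph V) (n : ℕ) (hn : Fintype.card V = n) (hn3 : 3 ≤ n)
    (hG : G.Connected) :
    steinerDiam G (n - 1) = n - 2 ↔ IsTwoConnected G := by
  classical
  subst hn
  have hcoe : ∀ v : V, ((({v} : Finset V)ᶜ : Finset V) : Set V) = {u : V | u ≠ v} := by
    intro v; ext; simp
  have hcard : ∀ v : V, (({v} : Finset V)ᶜ : Finset V).card = Fintype.card V - 1 := by
    intro v; rw [Finset.card_compl, Finset.card_singleton]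
  constructor
  · intro h
    refine ⟨hG, hn3, fun v => ?_⟩
    have hle : steinerDist G {u : V | u ≠ v} ≤ Fintype.card V - 2 := by
      rw [← h, ← hcoe v]
      exact Finset.le_sup (f := fun S : Finset V => steinerDist G (S : Set V))
        (Finset.mem_powersetCard.mpr ⟨Finset.subset_univ _, hcard v⟩)
    obtain ⟨H, hH, hS, he⟩ := steinerDist_attained G hG {u : V | u ≠ v}
    have h1 := subgraph_card_le H hH
    have h2 := ncard_ne v
    have heq : {u : V | u ≠ v} = H.verts :=
      Set.eq_of_subset_of_ncard_le hS (by omega) (Set.toFinite _)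
    rw [heq]
    exact hH.coe.mono fun a b hab => H.adj_sub hab
  · rintro ⟨-, -, h⟩
    apply le_antisymm
    · refine Finset.sup_le fun S hS => ?_
      obtain ⟨-, hS⟩ := Finset.mem_powersetCard.mp hS
      have h1 : Sᶜ.card = 1 := by rw [Finset.card_compl]; omega
      obtain ⟨v, hv⟩ := Finset.card_eq_one.mp h1
      obtain rfl : S = {v}ᶜ := by rw [← hv, compl_compl]
      rw [hcoe]
      obtain ⟨H, hH, hs, he⟩ := exists_tree_subgraph _ (h v)
      rw [ncard_ne] at he
      exact Nat.sInf_le ⟨H, hH, hs.ge, by omega⟩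
    · obtain ⟨v⟩ := hG.nonempty
      have h1 := le_steinerDist G hG {u : V | u ≠ v}
      rw [ncard_ne] at h1
      have h2 := Finset.le_sup (f := fun S : Finset V => steinerDist G (S : Set V))
        (Finset.mem_powersetCard.mpr ⟨Finset.subset_univ _, hcard v⟩)
      simp only [hcoe] at h2
      unfold steinerDiam
      omega
end
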